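/- Let K > 0 and let a, b : [0, 2] × [0, a*] → ℝ be continuous, locally Lipschitz in the second argument, with |a(τ, ρ)| ≤ Kρ and |b(τ, ρ)| ≤ Kρ² on their domain. Then there exists ρ₀ ∈ (0, min(a*, 1/K)) such that for every ρ• ∈ (0, ρ₀) the solution (τ̌, ρ̌) of τ̌′(s) = 1 + τ̌(s) + a(τ̌(s), ρ̌(s)), ρ̌′(s) = −(ρ̌(s) + b(τ̌(s), ρ̌(s))), with τ̌(0) = 0 and ρ̌(0) = ρ•, exists with ρ̌(s) ∈ (0, ρ•] for as long as τ̌(s) ≤ 1, and there is a parameter s₊ > 0 with τ̌(s₊) = 1 and ρ̌(s₊) > 0. That is, the outgoing characteristics of the Maxwell propagation equations on the Schwarzschild background intersect future null infinity τ = 1 at nonzero ρ. -/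

import Mathlib

open Set Filter Topology

/-- On a compact rectangle, a bounded function that is locally Lipschitz in its second argument
is Lipschitz in its second argument, uniformly in the first. -/
lemma exists_uniform_lipschitz_snd {t₀ t₁ x₀ x₁ M : ℝ} {f : ℝ → ℝ → ℝ}
    (hlip : ∀ q ∈ (Icc t₀ t₁ ×ˢ Icc x₀ x₁), ∃ ε > (0:ℝ), ∃ L : NNReal,
      ∀ t ∈ Icc t₀ t₁, |t - q.1| ≤ ε → ∀ x ∈ Icc x₀ x₁, ∀ y ∈ Icc x₀ x₁,
        |x - q.2| ≤ ε → |y - q.2| ≤ ε → |f t x - f t y| ≤ L * |x - y|)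
    (hbound : ∀ t ∈ Icc t₀ t₁, ∀ x ∈ Icc x₀ x₁, |f t x| ≤ M) :
    ∃ L : ℝ, 0 ≤ L ∧ ∀ t ∈ Icc t₀ t₁, ∀ x ∈ Icc x₀ x₁, ∀ y ∈ Icc x₀ x₁,
      |f t x - f t y| ≤ L * |x - y| := by
  have hcompact : IsCompact (Icc t₀ t₁ ×ˢ (Icc x₀ x₁ ×ˢ Icc x₀ x₁)) :=
    isCompact_Icc.prod (isCompact_Icc.prod isCompact_Icc)
  have key : ∃ L : ℝ, 0 ≤ L ∧ ∀ p ∈ Icc t₀ t₁ ×ˢ (Icc x₀ x₁ ×ˢ Icc x₀ x₁),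
      |f p.1 p.2.1 - f p.1 p.2.2| ≤ L * |p.2.1 - p.2.2| := by
    refine hcompact.induction_on (p := fun S : Set (ℝ × ℝ × ℝ) => ∃ L : ℝ, 0 ≤ L ∧ ∀ p ∈ S,
      |f p.1 p.2.1 - f p.1 p.2.2| ≤ L * |p.2.1 - p.2.2|) ⟨0, le_rfl, by simp⟩ ?_ ?_ ?_
    · rintro S T hST ⟨L, hL, h⟩
      exact ⟨L, hL, fun p hp => h p (hST hp)⟩
    · rintro S T ⟨L, hL, h⟩ ⟨L', -, h'⟩
      refine ⟨max L L', le_max_of_le_left hL, ?_⟩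
      rintro p (hp | hp)
      · exact (h p hp).trans (by gcongr; exact le_max_left _ _)
      · exact (h' p hp).trans (by gcongr; exact le_max_right _ _)
    · rintro ⟨t, x, y⟩ ⟨ht, hx, hy⟩
      rcases eq_or_ne x y with rfl | hxy
      · obtain ⟨ε, hε, L, hL⟩ := hlip (t, x) ⟨ht, hx⟩
        refine ⟨_, inter_mem_nhdsWithin _ (Metric.closedBall_mem_nhds (t, x, x) hε), L,
          L.2, ?_⟩
        rintro ⟨t', x', y'⟩ ⟨⟨ht', hx', hy'⟩, hball⟩
        simp only [Metric.mem_closedBall, Prod.dist_eq, Real.dist_eq, max_le_iff] at hball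
        exact hL t' ht' hball.1 x' hx' y' hy' hball.2.1 hball.2.2
      · have hd : 0 < |x - y| := abs_pos.2 (sub_ne_zero.2 hxy)
        have hM : 0 ≤ M := (abs_nonneg _).trans (hbound t ht x hx)
        have hcont : Continuous fun p : ℝ × ℝ × ℝ => |p.2.1 - p.2.2| := by fun_prop
        have hfar : {p : ℝ × ℝ × ℝ | |x - y| / 2 < |p.2.1 - p.2.2|} ∈ 𝓝 (t, x, y) :=
          (isOpen_lt continuous_const hcont).mem_nhds (half_lt_self hd)
        refine ⟨_, inter_mem_nhdsWithin _ hfar, 4 * M / |x - y|, by positivity, ?_⟩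
        rintro ⟨t', x', y'⟩ ⟨⟨ht', hx', hy'⟩, hp⟩
        rw [mem_ofPred_eq] at hp
        calc |f t' x' - f t' y'| ≤ |f t' x'| + |f t' y'| := abs_sub _ _
          _ ≤ M + M := add_le_add (hbound t' ht' x' hx') (hbound t' ht' y' hy')
          _ = 4 * M / |x - y| * (|x - y| / 2) := by field_simp; ring
          _ ≤ 4 * M / |x - y| * |x' - y'| := by gcongr
  obtain ⟨L, hL, h⟩ := key
  exact ⟨L, hL, fun t ht x hx y hy => h (t, x, y) ⟨ht, hx, hy⟩⟩

/-- A bounded continuous scalar vector field that is globally Lipschitz in the state has, for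
every initial value at time `0`, a solution around the time interval `[0, 1]`. -/
lemma exists_hasDerivAt_of_bounded_lipschitz {F : ℝ → ℝ → ℝ} {C L : ℝ} (x₀ : ℝ)
    (hcont : ∀ x, Continuous (F · x)) (hbound : ∀ t x, |F t x| ≤ C) (hL : 0 ≤ L)
    (hlip : ∀ t x y, |F t x - F t y| ≤ L * |x - y|) :
    ∃ r : ℝ → ℝ, r 0 = x₀ ∧ ∀ t ∈ Icc (0:ℝ) 1, HasDerivAt r (F t (r t)) t := by
  have hC : 0 ≤ C := (abs_nonneg _).trans (hbound 0 0)
  have h0 : (0:ℝ) ∈ Icc (-1:ℝ) 2 := by norm_num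
  have hpl : IsPicardLindelof F (⟨0, h0⟩ : Icc (-1:ℝ) 2) x₀ (C.toNNReal * 2) 0 C.toNNReal
      L.toNNReal :=
    { lipschitzOnWith := fun t _ => (LipschitzWith.of_dist_le_mul fun x y => by
        simpa [Real.dist_eq, Real.coe_toNNReal _ hL] using hlip t x y).lipschitzOnWith
      continuousOn := fun x _ => (hcont x).continuousOn
      norm_le := fun t _ x _ => by simpa [Real.coe_toNNReal _ hC] using hbound t x
      mul_max_le := by simp }
  obtain ⟨r, hr0, hr⟩ := hpl.exists_eq_forall_mem_Icc_hasDerivWithinAt₀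
  exact ⟨r, hr0, fun t ht => (hr t ⟨by linarith [ht.1], by linarith [ht.2]⟩).hasDerivAt
    (Icc_mem_nhds (by linarith [ht.1]) (by linarith [ht.2]))⟩

/-- An autonomous scalar equation with a continuous, positive and bounded right-hand side has a
global solution through `0`, which is an increasing bijection of the line. -/
lemma exists_orderIso_hasDerivAt {d : ℝ → ℝ} {C : ℝ} (hcont : Continuous d)
    (hpos : ∀ t, 0 < d t) (hle : ∀ t, d t ≤ C) :
    ∃ σ : ℝ ≃o ℝ, σ 0 = 0 ∧ ∀ s, HasDerivAt σ (d (σ s)) s := by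
  have hC : 0 < C := (hpos 0).trans_le (hle 0)
  set S : ℝ → ℝ := fun u => ∫ t in (0:ℝ)..u, (d t)⁻¹ with hS
  have hderiv : ∀ u, HasDerivAt S (d u)⁻¹ u := fun u =>
    ((hcont.inv₀ fun t => (hpos t).ne').integral_hasStrictDerivAt 0 u).hasDerivAt
  have hScont : Continuous S := continuous_iff_continuousAt.2 fun u => (hderiv u).continuousAt
  have hS0 : S 0 = 0 := by simp [hS]
  have hmono : StrictMono S := strictMono_of_deriv_pos fun u => by
    rw [(hderiv u).deriv]; exact inv_pos.2 (hpos u)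
  have hgrow : Monotone fun u => S u - C⁻¹ * u :=
    monotone_of_hasDerivAt_nonneg (f' := fun u => (d u)⁻¹ - C⁻¹ * 1)
      (fun u => (hderiv u).sub ((hasDerivAt_id u).const_mul _)) fun u => by
        simpa using inv_anti₀ (hpos u) (hle u)
  have hsurj : Function.Surjective S := by
    refine hScont.surjective ?_ ?_
    · refine tendsto_atTop_mono' _ ?_ (tendsto_id.const_mul_atTop (inv_pos.2 hC))
      filter_upwards [eventually_ge_atTop 0] with u hu
      simpa [hS0] using hgrow hu
    · refine tendsto_atBot_mono' _ ?_ (tendsto_id.const_mul_atBot (inv_pos.2 hC))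
      filter_upwards [eventually_le_atBot 0] with u hu
      simpa [hS0] using hgrow hu
  let e := hmono.orderIsoOfSurjective S hsurj
  have he : ∀ u, e u = S u := fun u => rfl
  refine ⟨e.symm, by rw [OrderIso.symm_apply_eq, he, hS0], fun s => ?_⟩
  simpa using (hderiv (e.symm s)).of_local_left_inverse e.symm.continuous.continuousAt
    (inv_ne_zero (hpos _).ne') (Eventually.of_forall fun y => e.apply_symm_apply y)

/-- The quotient of two Lipschitz quantities, with numerator bounded and denominator bounded
below by `1 / 2`. -/
lemma abs_div_sub_div_le {n₁ n₂ d₁ d₂ B P Q δ : ℝ} (hn : |n₂| ≤ B) (hd₁ : 1 / 2 ≤ d₁)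
    (hd₂ : 1 / 2 ≤ d₂) (hnum : |n₁ - n₂| ≤ P * δ) (hden : |d₁ - d₂| ≤ Q * δ) :
    |n₁ / d₁ - n₂ / d₂| ≤ (2 * P + 4 * B * Q) * δ := by
  have h₁ : 0 < d₁ := by linarith
  have h₂ : 0 < d₂ := by linarith
  have hi₁ : |d₁⁻¹| ≤ 2 := by
    rw [abs_of_pos (inv_pos.2 h₁)]; exact inv_le_of_inv_le₀ (by norm_num) (by linarith)
  have hi₂ : |d₂⁻¹| ≤ 2 := by
    rw [abs_of_pos (inv_pos.2 h₂)]; exact inv_le_of_inv_le₀ (by norm_num) (by linarith)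
  have hB : 0 ≤ B := (abs_nonneg _).trans hn
  have hP : 0 ≤ P * δ := (abs_nonneg _).trans hnum
  have hQ : 0 ≤ Q * δ := (abs_nonneg _).trans hden
  calc |n₁ / d₁ - n₂ / d₂|
      = |(n₁ - n₂) * d₁⁻¹ - n₂ * (d₁ - d₂) * (d₁⁻¹ * d₂⁻¹)| := by
        congr 1; field_simp; ring
    _ ≤ |n₁ - n₂| * |d₁⁻¹| + |n₂| * |d₁ - d₂| * (|d₁⁻¹| * |d₂⁻¹|) := by
        simpa only [abs_mul] using abs_sub ((n₁ - n₂) * d₁⁻¹) (n₂ * (d₁ - d₂) * (d₁⁻¹ * d₂⁻¹))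
    _ ≤ P * δ * 2 + B * (Q * δ) * (2 * 2) := by gcongr
    _ = (2 * P + 4 * B * Q) * δ := by ring


/- Outgoing characteristics on the Schwarzschild background reach future null
infinity `τ = 1` at nonzero `ρ`: if `a`, `b` are continuous on `[0,2] × [0,a*]`,
locally Lipschitz in the second argument, with `|a| ≤ Kρ` and `|b| ≤ Kρ²`, then
there is `ρ₀ ∈ (0, min(a*, 1/K))` such that for every starting value `ρ• ∈ (0, ρ₀)`
the solution of `τ̌′ = 1 + τ̌ + a(τ̌, ρ̌)`, `ρ̌′ = −(ρ̌ + b(τ̌, ρ̌))`, `τ̌(0) = 0`,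
`ρ̌(0) = ρ•` exists with `ρ̌ ∈ (0, ρ•]` as long as `τ̌ ≤ 1`, and hits `τ̌ = 1`
at some `s₊ > 0` with `ρ̌(s₊) > 0`. -/
theorem statement7 (K astar : ℝ) (hK : 0 < K) (hastar : 0 < astar)
    (a b : ℝ → ℝ → ℝ)
    (ha_cont : ContinuousOn (fun q : ℝ × ℝ => a q.1 q.2)
      (Set.Icc 0 2 ×ˢ Set.Icc 0 astar))
    (hb_cont : ContinuousOn (fun q : ℝ × ℝ => b q.1 q.2)
      (Set.Icc 0 2 ×ˢ Set.Icc 0 astar))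
    (ha_lip : ∀ q ∈ (Set.Icc (0:ℝ) 2 ×ˢ Set.Icc (0:ℝ) astar), ∃ ε > (0:ℝ), ∃ L : NNReal,
      ∀ τ ∈ Set.Icc (0:ℝ) 2, |τ - q.1| ≤ ε →
        ∀ ρ₁ ∈ Set.Icc (0:ℝ) astar, ∀ ρ₂ ∈ Set.Icc (0:ℝ) astar,
          |ρ₁ - q.2| ≤ ε → |ρ₂ - q.2| ≤ ε → |a τ ρ₁ - a τ ρ₂| ≤ L * |ρ₁ - ρ₂|)
    (hb_lip : ∀ q ∈ (Set.Icc (0:ℝ) 2 ×ˢ Set.Icc (0:ℝ) astar), ∃ ε > (0:ℝ), ∃ L : NNReal,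
      ∀ τ ∈ Set.Icc (0:ℝ) 2, |τ - q.1| ≤ ε →
        ∀ ρ₁ ∈ Set.Icc (0:ℝ) astar, ∀ ρ₂ ∈ Set.Icc (0:ℝ) astar,
          |ρ₁ - q.2| ≤ ε → |ρ₂ - q.2| ≤ ε → |b τ ρ₁ - b τ ρ₂| ≤ L * |ρ₁ - ρ₂|)
    (ha_bound : ∀ τ ∈ Set.Icc (0:ℝ) 2, ∀ ρ ∈ Set.Icc (0:ℝ) astar, |a τ ρ| ≤ K * ρ)
    (hb_bound : ∀ τ ∈ Set.Icc (0:ℝ) 2, ∀ ρ ∈ Set.Icc (0:ℝ) astar, |b τ ρ| ≤ K * ρ ^ 2) :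
    ∃ ρ₀ ∈ Set.Ioo (0:ℝ) (min astar (1/K)), ∀ ρb ∈ Set.Ioo (0:ℝ) ρ₀,
      ∃ sp : ℝ, 0 < sp ∧ ∃ τc ρc : ℝ → ℝ,
        τc 0 = 0 ∧ ρc 0 = ρb ∧
        (∀ s ∈ Set.Icc (0:ℝ) sp,
          HasDerivAt τc (1 + τc s + a (τc s) (ρc s)) s ∧
          HasDerivAt ρc (-(ρc s + b (τc s) (ρc s))) s ∧
          τc s ≤ 1 ∧ ρc s ∈ Set.Ioc (0:ℝ) ρb) ∧
        τc sp = 1 ∧ 0 < ρc sp := by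
  have hm : 0 < min astar (1 / K) := lt_min hastar (by positivity)
  refine ⟨min astar (1 / K) / 2, ⟨by linarith, by linarith⟩, ?_⟩
  rintro ρb ⟨hρ0, hρ⟩
  have hρa : ρb ≤ astar := by linarith [min_le_left astar (1 / K)]
  have hKρ : K * ρb ≤ 1 / 2 := by
    have h : K * (1 / K) = 1 := by field_simp
    nlinarith [min_le_right astar (1 / K)]
  obtain ⟨La, hLa, ha_lip⟩ := exists_uniform_lipschitz_snd ha_lip fun τ hτ ρ hρ =>
    (ha_bound τ hτ ρ hρ).trans (mul_le_mul_of_nonneg_left hρ.2 hK.le)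
  obtain ⟨Lb, hLb, hb_lip⟩ := exists_uniform_lipschitz_snd hb_lip fun τ hτ ρ hρ =>
    (hb_bound τ hτ ρ hρ).trans
      (mul_le_mul_of_nonneg_left (pow_le_pow_left₀ hρ.1 hρ.2 2) hK.le)
  -- The vector field frozen outside `[0, 2] × [0, ρb]`.
  set T : ℝ → ℝ := fun τ => projIcc (0:ℝ) 2 zero_le_two τ with hT
  set R : ℝ → ℝ := fun x => projIcc (0:ℝ) ρb hρ0.le x with hR
  have hT_mem : ∀ τ, T τ ∈ Icc (0:ℝ) 2 := fun τ => (projIcc (0:ℝ) 2 zero_le_two τ).2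
  have hR_mem : ∀ x, R x ∈ Icc (0:ℝ) ρb := fun x => (projIcc (0:ℝ) ρb hρ0.le x).2
  have hR_mem' : ∀ x, R x ∈ Icc (0:ℝ) astar := fun x =>
    ⟨(hR_mem x).1, (hR_mem x).2.trans hρa⟩
  have hT_eq : ∀ τ ∈ Icc (0:ℝ) 1, T τ = τ := fun τ hτ => by
    simp only [hT, projIcc_of_mem zero_le_two (show τ ∈ Icc (0:ℝ) 2 from
      ⟨hτ.1, by linarith [hτ.2]⟩)]
  have hR_eq : ∀ x ∈ Icc (0:ℝ) ρb, R x = x := fun x hx => by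
    simp only [hR, projIcc_of_mem hρ0.le hx]
  have hT_cont : Continuous T := continuous_subtype_val.comp continuous_projIcc
  have hR_cont : Continuous R := continuous_subtype_val.comp continuous_projIcc
  have hR_lip : ∀ x y, |R x - R y| ≤ |x - y| := fun x y => abs_projIcc_sub_projIcc hρ0.le
  set D : ℝ → ℝ → ℝ := fun τ x => 1 + T τ + a (T τ) (R x) with hD
  set N : ℝ → ℝ → ℝ := fun τ x => R x + b (T τ) (R x) with hN
  have hpair : Continuous fun q : ℝ × ℝ => (T q.1, R q.2) := by fun_prop
  have ha_comp : Continuous fun q : ℝ × ℝ => a (T q.1) (R q.2) :=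
    ha_cont.comp_continuous hpair fun q => ⟨hT_mem _, hR_mem' _⟩
  have hb_comp : Continuous fun q : ℝ × ℝ => b (T q.1) (R q.2) :=
    hb_cont.comp_continuous hpair fun q => ⟨hT_mem _, hR_mem' _⟩
  have hD_cont : Continuous fun q : ℝ × ℝ => D q.1 q.2 :=
    (continuous_const.add (hT_cont.comp continuous_fst)).add ha_comp
  have hN_cont : Continuous fun q : ℝ × ℝ => N q.1 q.2 :=
    (hR_cont.comp continuous_snd).add hb_comp
  have ha_half : ∀ τ x, |a (T τ) (R x)| ≤ 1 / 2 := fun τ x =>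
    (ha_bound _ (hT_mem τ) _ (hR_mem' x)).trans
      ((mul_le_mul_of_nonneg_left (hR_mem x).2 hK.le).trans hKρ)
  have hb_half : ∀ τ x, |b (T τ) (R x)| ≤ R x / 2 := fun τ x => by
    refine (hb_bound _ (hT_mem τ) _ (hR_mem' x)).trans ?_
    have := mul_le_mul_of_nonneg_left (hR_mem x).2 hK.le
    nlinarith [(hR_mem x).1]
  have hD_ge : ∀ τ x, 1 / 2 ≤ D τ x := fun τ x => by
    simp only [hD]; linarith [(abs_le.1 (ha_half τ x)).1, (hT_mem τ).1]
  have hD_pos : ∀ τ x, 0 < D τ x := fun τ x => by linarith [hD_ge τ x]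
  have hD_le : ∀ τ x, D τ x ≤ 4 := fun τ x => by
    simp only [hD]; linarith [(abs_le.1 (ha_half τ x)).2, (hT_mem τ).2]
  have hN_nonneg : ∀ τ x, 0 ≤ N τ x := fun τ x => by
    simp only [hN]; linarith [(abs_le.1 (hb_half τ x)).1, (hR_mem x).1]
  have hN_le : ∀ τ x, N τ x ≤ 2 * R x := fun τ x => by
    simp only [hN]; linarith [(abs_le.1 (hb_half τ x)).2, (hR_mem x).1]
  have hN_abs : ∀ τ x, |N τ x| ≤ 2 * ρb := fun τ x => by
    rw [abs_of_nonneg (hN_nonneg τ x)]; linarith [hN_le τ x, (hR_mem x).2]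
  have hG_nonneg : ∀ τ x, 0 ≤ N τ x / D τ x := fun τ x =>
    div_nonneg (hN_nonneg τ x) (hD_pos τ x).le
  have hG_le : ∀ τ x, N τ x / D τ x ≤ 4 * R x := fun τ x => by
    rw [div_le_iff₀ (hD_pos τ x)]
    nlinarith [hN_le τ x, hD_ge τ x, (hR_mem x).1]
  have hD_lip : ∀ τ x y, |D τ x - D τ y| ≤ La * |x - y| := fun τ x y => by
    simp only [hD, add_sub_add_left_eq_sub]
    exact (ha_lip _ (hT_mem τ) _ (hR_mem' x) _ (hR_mem' y)).trans
      (mul_le_mul_of_nonneg_left (hR_lip x y) hLa)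
  have hN_lip : ∀ τ x y, |N τ x - N τ y| ≤ (1 + Lb) * |x - y| := fun τ x y => by
    calc |N τ x - N τ y| = |(R x - R y) + (b (T τ) (R x) - b (T τ) (R y))| := by
          simp only [hN]; congr 1; ring
      _ ≤ |R x - R y| + Lb * |R x - R y| := (abs_add_le _ _).trans
          (by gcongr; exact hb_lip _ (hT_mem τ) _ (hR_mem' x) _ (hR_mem' y))
      _ ≤ |x - y| + Lb * |x - y| := add_le_add (hR_lip x y)
          (mul_le_mul_of_nonneg_left (hR_lip x y) hLb)
      _ = (1 + Lb) * |x - y| := by ring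
  -- The characteristic as a graph over `τ`.
  obtain ⟨r, hr0, hr⟩ := exists_hasDerivAt_of_bounded_lipschitz (F := fun τ x => -(N τ x / D τ x))
    (C := 4 * ρb) (L := 2 * (1 + Lb) + 4 * (2 * ρb) * La) ρb
    (fun x => ((hN_cont.comp (Continuous.prodMk_left x)).div
      (hD_cont.comp (Continuous.prodMk_left x)) fun τ => (hD_pos τ x).ne').neg)
    (fun τ x => by
      rw [abs_neg, abs_of_nonneg (hG_nonneg τ x)]; linarith [hG_le τ x, (hR_mem x).2])
    (by positivity)
    (fun τ x y => by
      rw [neg_sub_neg, abs_sub_comm]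
      exact abs_div_sub_div_le (hN_abs τ y) (hD_ge τ x) (hD_ge τ y) (hN_lip τ x y)
        (hD_lip τ x y))
  have hr_cont : ContinuousOn r (Icc 0 1) := fun τ hτ => (hr τ hτ).continuousAt.continuousWithinAt
  have hr_le : ∀ τ ∈ Icc (0:ℝ) 1, r τ ≤ ρb := fun τ hτ => by
    have hanti : AntitoneOn r (Icc 0 1) := antitoneOn_of_hasDerivWithinAt_nonpos (convex_Icc 0 1)
      hr_cont (fun t ht => (hr t (interior_subset ht)).hasDerivWithinAt)
      fun t _ => neg_nonpos.2 (hG_nonneg t (r t))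
    exact (hanti (left_mem_Icc.2 zero_le_one) hτ hτ.1).trans_eq hr0
  have hr_pos : ∀ τ ∈ Icc (0:ℝ) 1, 0 < r τ := fun τ hτ => by
    have hfence := image_le_of_deriv_right_lt_deriv_boundary (f := fun t => -r t)
      (B := fun t => -(ρb * Real.exp (-5 * t))) (B' := fun t => 5 * (ρb * Real.exp (-5 * t)))
      hr_cont.neg (fun t ht => (hr t (Ico_subset_Icc_self ht)).neg.hasDerivWithinAt)
      (by simp [hr0])
      (fun t => by
        refine (((hasDerivAt_id t).const_mul (-5)).exp.const_mul ρb).neg.congr_deriv ?_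
        simp only [id]
        ring)
      (fun t ht heq => by
        have hpos : 0 < ρb * Real.exp (-5 * t) := by positivity
        have heq' : r t = ρb * Real.exp (-5 * t) := neg_injective heq
        have hle := hG_le t (r t)
        rw [hR_eq (r t) ⟨by linarith, hr_le t (Ico_subset_Icc_self ht)⟩] at hle
        simp only [neg_neg]
        linarith) hτ
    have hpos : 0 < ρb * Real.exp (-5 * τ) := by positivity
    linarith
  -- Reparametrise by the original parameter `s`.
  set I : ℝ → ℝ := fun τ => projIcc (0:ℝ) 1 zero_le_one τ with hI
  have hrI : Continuous fun τ => r (I τ) := hr_cont.comp_continuous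
    (continuous_subtype_val.comp continuous_projIcc) fun τ => (projIcc (0:ℝ) 1 zero_le_one τ).2
  obtain ⟨σ, hσ0, hσ⟩ := exists_orderIso_hasDerivAt (d := fun τ => D τ (r (I τ)))
    (hD_cont.comp (continuous_id.prodMk hrI)) (fun τ => hD_pos _ _) (fun τ => hD_le _ _)
  have hsp : 0 < σ.symm 1 := by rw [OrderIso.lt_symm_apply, hσ0]; exact one_pos
  have hσ1 : σ (σ.symm 1) = 1 := σ.apply_symm_apply 1
  refine ⟨σ.symm 1, hsp, σ, fun s => r (σ s), hσ0, by simp [hσ0, hr0], fun s hs => ?_, hσ1,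
    hr_pos _ (by simp)⟩
  have hτ : σ s ∈ Icc (0:ℝ) 1 :=
    ⟨by simpa [hσ0] using σ.monotone hs.1, by simpa using σ.monotone hs.2⟩
  have hmem : r (σ s) ∈ Ioc 0 ρb := ⟨hr_pos _ hτ, hr_le _ hτ⟩
  have hIs : I (σ s) = σ s := by simp only [hI, projIcc_of_mem zero_le_one hτ]
  have hτ' := hσ s
  simp only [hIs] at hτ'
  have hDs : D (σ s) (r (σ s)) = 1 + σ s + a (σ s) (r (σ s)) := by
    simp only [hD, hT_eq _ hτ, hR_eq _ (Ioc_subset_Icc_self hmem)]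
  have hNs : N (σ s) (r (σ s)) = r (σ s) + b (σ s) (r (σ s)) := by
    simp only [hN, hT_eq _ hτ, hR_eq _ (Ioc_subset_Icc_self hmem)]
  refine ⟨hDs ▸ hτ', ?_, hτ.2, hmem⟩
  refine ((hr _ hτ).comp s hτ').congr_deriv ?_
  rw [neg_mul, div_mul_cancel₀ _ (hD_pos _ _).ne', hNs]
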